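/- Let μ ∈ (0,1) and let c be such that −c is less than the smallest critical value of the Jacobi Hamiltonian H. Then Σ_{μ,c} is a compact regular hypersurface in ℝ⁴ ≅ ℂ² which is starshaped with respect to the origin: for every x ∈ ℝ⁴∖{0}, the ray {t·x : t > 0} intersects Σ_{μ,c} in exactly one point. In particular Σ_{μ,c} is diffeomorphic to the 3-sphere S³. Moreover, Σ_{μ,c} is invariant under the symplectic involution s(z,w) = (−z,−w). -/

import Mathlib

open Matrix Set

noncomputable section

/-- Phase space ℝ⁴. -/
abbrev V4 := Fin 4 → ℝ

/-- 2×2 real matrices. -/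
abbrev M2 := Matrix (Fin 2) (Fin 2) ℝ

/-- Euclidean norm on ℝ⁴. -/
def enorm4 (v : V4) : ℝ := Real.sqrt (∑ i, (v i)^2)

/-- The gradient of `H : ℝ⁴ → ℝ` with respect to the standard Euclidean structure. -/
def gradient4 (H : V4 → ℝ) (x : V4) : V4 := fun i => fderiv ℝ H x (Pi.single i (1:ℝ))

/-- The Hamiltonian vector field of `H` with respect to the symplectic form `dw ∧ dz`
in coordinates `(z₁, z₂, w₁, w₂)`:  ż = ∂H/∂w, ẇ = -∂H/∂z  (i.e. X_H = I₄∇H). -/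
def symplGrad (H : V4 → ℝ) (x : V4) : V4 :=
  ![fderiv ℝ H x (Pi.single (2:Fin 4) (1:ℝ)), fderiv ℝ H x (Pi.single (3:Fin 4) (1:ℝ)),
    -fderiv ℝ H x (Pi.single (0:Fin 4) (1:ℝ)), -fderiv ℝ H x (Pi.single (1:Fin 4) (1:ℝ))]

/-- `γ : ℝ → ℝ⁴` is a solution of Hamilton's equations for `H` staying in the domain `D`. -/
def IsOrbit (H : V4 → ℝ) (D : Set V4) (γ : ℝ → V4) : Prop :=
  ∀ t : ℝ, γ t ∈ D ∧ HasDerivAt γ (symplGrad H (γ t)) t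

/-- The Jacobi Hamiltonian of the planar restricted three-body problem, in coordinates
`(q₁, q₂, p₁, p₂)`:  H = ½|p|² + q₁p₂ - q₂p₁ - (1-μ)/|q-(-μ,0)| - μ/|q-(1-μ,0)|. -/
def JacobiH (μ : ℝ) (x : V4) : ℝ :=
  (1/2) * ((x 2)^2 + (x 3)^2) + x 0 * x 3 - x 1 * x 2
    - (1 - μ) / Real.sqrt ((x 0 + μ)^2 + (x 1)^2)
    - μ / Real.sqrt ((x 0 - (1 - μ))^2 + (x 1)^2)

/-- The domain of the Jacobi Hamiltonian: `q ∉ {(-μ,0), (1-μ,0)}`. -/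
def JacobiDom (μ : ℝ) : Set V4 :=
  {x | (x 0, x 1) ≠ (-μ, 0) ∧ (x 0, x 1) ≠ (1 - μ, 0)}

/-- The set of critical values of the Jacobi Hamiltonian. -/
def JacobiCritVals (μ : ℝ) : Set ℝ :=
  {v | ∃ x ∈ JacobiDom μ, fderiv ℝ (JacobiH μ) x = 0 ∧ JacobiH μ x = v}

/-- The first critical energy `c₁(μ) = -H(L₁)`, where `H(L₁)` is the smallest critical
value of the Jacobi Hamiltonian. -/
def firstCritEnergy (μ : ℝ) : ℝ := -sInf (JacobiCritVals μ)

/-- `|2z² - 1|` as a function of `(z₁, z₂)`, where `z = z₁ + i z₂`. -/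
def lcAbs (z1 z2 : ℝ) : ℝ := Real.sqrt ((2*(z1^2 - z2^2) - 1)^2 + (4*z1*z2)^2)

/-- The domain of the Levi-Civita Hamiltonian: `2z² ≠ 1`. -/
def LCDom : Set V4 := {x | lcAbs (x 0) (x 1) ≠ 0}

/-- The Levi-Civita Hamiltonian `K_{μ,c}` in coordinates `(z₁, z₂, w₁, w₂)`. -/
def Kham (μ c : ℝ) (x : V4) : ℝ :=
  (1/2) * ((x 2)^2 + (x 3)^2) + c * ((x 0)^2 + (x 1)^2) - (1 - μ)/2
    + 2 * ((x 0)^2 + (x 1)^2) * (x 0 * x 3 - x 1 * x 2)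
    - μ * (x 0 * x 3 + x 1 * x 2)
    - μ * ((x 0)^2 + (x 1)^2) / lcAbs (x 0) (x 1)

/-- `Σ_{μ,c}`: the connected component of `K_{μ,c}⁻¹(0)` containing the circle
`{(0,w) : |w|² = 1-μ}` (we use the point `(0,0,√(1-μ),0)` of that circle). -/
def SigmaLC (μ c : ℝ) : Set V4 :=
  connectedComponentIn {x : V4 | x ∈ LCDom ∧ Kham μ c x = 0} ![0, 0, Real.sqrt (1 - μ), 0]

/-- The anti-symplectic involution `R₊(z,w) = (z̄, -w̄)`. -/
def Rplus (x : V4) : V4 := ![x 0, -x 1, -x 2, x 3]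

/-- The anti-symplectic involution `R₋(z,w) = (-z̄, w̄)`. -/
def Rminus (x : V4) : V4 := ![-x 0, x 1, x 2, -x 3]

/-- A `T`-periodic orbit of the Levi-Civita Hamiltonian flow lying on `Σ_{μ,c}`. -/
def IsClosedOrbit (μ c T : ℝ) (γ : ℝ → V4) : Prop :=
  0 < T ∧ IsOrbit (Kham μ c) LCDom γ ∧ (∀ t, γ (t + T) = γ t) ∧ ∀ t, γ t ∈ SigmaLC μ c

/-- A `T`-periodic orbit is symmetric if, after a time shift, `γ(t) = R₊(γ(T-t))` for all `t`
or `γ(t) = R₋(γ(T-t))` for all `t`. -/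
def IsSymmetricOrbit (T : ℝ) (γ : ℝ → V4) : Prop :=
  ∃ s : ℝ, (∀ t, γ (s + t) = Rplus (γ (s + (T - t))))
         ∨ (∀ t, γ (s + t) = Rminus (γ (s + (T - t))))

/-- An orbit `(z(t),w(t))` is retrograde if `z₁w₂ - z₂w₁ > μ(z₁² - z₂²)` along it. -/
def IsRetrograde (μ : ℝ) (γ : ℝ → V4) : Prop :=
  ∀ t : ℝ, μ * ((γ t 0)^2 - (γ t 1)^2) < γ t 0 * γ t 3 - γ t 1 * γ t 2

/-- An orbit `(z(t),w(t))` is direct if `z₁w₂ - z₂w₁ < μ(z₁² - z₂²)` along it. -/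
def IsDirect (μ : ℝ) (γ : ℝ → V4) : Prop :=
  ∀ t : ℝ, γ t 0 * γ t 3 - γ t 1 * γ t 2 < μ * ((γ t 0)^2 - (γ t 1)^2)

/-- The crossing number of a `T`-periodic orbit: `#{t ∈ [0,T) : z₁(t) = 0 or z₂(t) = 0}`. -/
def crossingNumber (T : ℝ) (γ : ℝ → V4) : ℕ :=
  {t ∈ Set.Ico (0:ℝ) T | γ t 0 = 0 ∨ γ t 1 = 0}.ncard

/-- `γ'` is a reparametrization (time shift) of `γ`. -/
def IsTimeShift (γ γ' : ℝ → V4) : Prop := ∃ s : ℝ, ∀ t, γ' t = γ (t + s)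

/-- The action `𝒜(γ) = ∫₀ᵀ (w·ż - z·ẇ) dt` of a `T`-periodic Levi-Civita orbit. -/
def orbitAction (μ c T : ℝ) (γ : ℝ → V4) : ℝ :=
  ∫ t in (0:ℝ)..T,
    (γ t 2 * symplGrad (Kham μ c) (γ t) 0 + γ t 3 * symplGrad (Kham μ c) (γ t) 1
      - γ t 0 * symplGrad (Kham μ c) (γ t) 2 - γ t 1 * symplGrad (Kham μ c) (γ t) 3)

/-- Transverse non-degeneracy of a `T`-periodic orbit `γ` of `X_H` on a regular level set:
any `T`-periodic solution of the variational equation along `γ` starting tangent to the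
level set is a multiple of the Hamiltonian vector field. -/
def TransverseNondeg (H : V4 → ℝ) (T : ℝ) (γ : ℝ → V4) : Prop :=
  ∀ v : ℝ → V4,
    (∀ t : ℝ, HasDerivAt v (fderiv ℝ (symplGrad H) (γ t) (v t)) t) →
    v T = v 0 →
    fderiv ℝ H (γ 0) (v 0) = 0 →
    ∃ a : ℝ, v 0 = a • symplGrad H (γ 0)

/-- `T` is the minimal period of `γ`. -/
def IsMinimalPeriod (T : ℝ) (γ : ℝ → V4) : Prop :=
  0 < T ∧ (∀ t, γ (t + T) = γ t) ∧ ∀ T' : ℝ, 0 < T' → (∀ t, γ (t + T') = γ t) → T ≤ T'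

/-- The quaternionic matrix `I₄`. -/
def I4 : Matrix (Fin 4) (Fin 4) ℝ := !![0,0,1,0; 0,0,0,1; -1,0,0,0; 0,-1,0,0]

/-- The quaternionic matrix `J₄`. -/
def J4 : Matrix (Fin 4) (Fin 4) ℝ := !![0,1,0,0; -1,0,0,0; 0,0,0,-1; 0,0,1,0]

/-- The quaternionic matrix `K₄`. -/
def K4 : Matrix (Fin 4) (Fin 4) ℝ := !![0,0,0,-1; 0,0,1,0; 0,-1,0,0; 1,0,0,0]

/-- `Ω₂ = [[0,1],[-1,0]]`. -/
def Omega2 : M2 := !![0,1; -1,0]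

/-- `Ω₄ = -I₄`. -/
def Omega4 : Matrix (Fin 4) (Fin 4) ℝ := -I4

/-- The 4×2 frame matrix `F(x) = [U(x) V(x)]` with `U = J₄∇H/‖∇H‖`, `V = K₄∇H/‖∇H‖`. -/
def frameF (H : V4 → ℝ) (x : V4) : Matrix (Fin 4) (Fin 2) ℝ :=
  Matrix.of fun i j =>
    (if j = 0 then J4.mulVec (gradient4 H x) i else K4.mulVec (gradient4 H x) i)
      / enorm4 (gradient4 H x)

/-- `M` is the linearized flow `t ↦ dFl_t(γ(0))` along the orbit `γ` of `X_H`: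
`M(0) = id` and each column solves the variational equation. -/
def IsLinearizedFlow (H : V4 → ℝ) (γ : ℝ → V4) (M : ℝ → Matrix (Fin 4) (Fin 4) ℝ) : Prop :=
  M 0 = 1 ∧ ∀ j : Fin 4, ∀ t : ℝ,
    HasDerivAt (fun s => fun i => M s i j)
      (fderiv ℝ (symplGrad H) (γ t) (fun i => M t i j)) t

/-- The reduced monodromy path `Ψ(t) = Ω₂ᵀ F(γ(t))ᵀ Ω₄ M(t) F(γ(0))`. -/
def reducedMonodromy (H : V4 → ℝ) (γ : ℝ → V4)
    (M : ℝ → Matrix (Fin 4) (Fin 4) ℝ) (t : ℝ) : M2 :=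
  Omega2ᵀ * (frameF H (γ t))ᵀ * Omega4 * M t * frameF H (γ 0)

/-- The retraction `ρ(Ψ) = (ΨΨᵀ)^{-1/2}Ψ` of `SL(2,ℝ)` onto `SO(2)`, written explicitly. -/
def rho (Ψ : M2) : M2 :=
  (1 / Real.sqrt ((Ψ 0 0 + Ψ 1 1)^2 + (Ψ 0 1 - Ψ 1 0)^2)) •
    !![Ψ 0 0 + Ψ 1 1, Ψ 0 1 - Ψ 1 0; -(Ψ 0 1 - Ψ 1 0), Ψ 0 0 + Ψ 1 1]

/-- The rotation by angle `θ`. -/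
def rotMat (θ : ℝ) : M2 := !![Real.cos θ, -Real.sin θ; Real.sin θ, Real.cos θ]

/-- The Conley-Zehnder index of the path `ψ : [0,T] → SL(2,ℝ)` equals `k`: there is a
continuous angle `θ` with `θ(0) = 0` lifting `t ↦ ρ(ψ(t))`, and `k` is the even integer
closest to `θ(T)/π` if `tr ψ(T) > 2`, the odd integer closest to `θ(T)/π` if `tr ψ(T) < 2`. -/
def CZIndexIs (T : ℝ) (ψ : ℝ → M2) (k : ℤ) : Prop :=
  ∃ θ : ℝ → ℝ, ContinuousOn θ (Set.Icc 0 T) ∧ θ 0 = 0 ∧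
    (∀ t ∈ Set.Icc (0:ℝ) T, rho (ψ t) = rotMat (θ t)) ∧
    (((2:ℝ) < (ψ T).trace ∧ Even k) ∨ ((ψ T).trace < 2 ∧ Odd k)) ∧
    |θ T / Real.pi - (k:ℝ)| < 1

end
/-- The radial profile `s ↦ -s²/2 - 1/s` of the effective potential. -/
noncomputable def effProfile (s : ℝ) : ℝ := -s ^ 2 / 2 - 1 / s

/-- The derivative of `effProfile`. -/
noncomputable def effProfileDeriv (s : ℝ) : ℝ := 1 / s ^ 2 - s

/-- The effective potential in bipolar coordinates: `r` and `ρ` are the distances to the primaries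
of mass `1 - μ` and `μ`. -/
noncomputable def effPotential (μ r ρ : ℝ) : ℝ :=
  (1 - μ) * effProfile r + μ * effProfile ρ + μ * (1 - μ) / 2

/-- The radial derivative, away from the primary of mass `1 - μ`, of the effective potential. -/
noncomputable def effRadialDeriv (μ r ρ : ℝ) : ℝ :=
  (1 - μ) * effProfileDeriv r + μ * (effProfileDeriv ρ * ((r ^ 2 + ρ ^ 2 - 1) / (2 * ρ * r)))

theorem hasDerivAt_effProfile {s : ℝ} (hs : s ≠ 0) :
    HasDerivAt effProfile (effProfileDeriv s) s := by
  unfold effProfile effProfileDeriv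
  have h := (((hasDerivAt_id s).pow 2).neg.div_const 2).sub ((hasDerivAt_inv hs))
  convert! h using 1
  · ext; simp
  · simp; field_simp; ring

theorem hasDerivAt_effProfileDeriv {s : ℝ} (hs : s ≠ 0) :
    HasDerivAt effProfileDeriv (-2 / s ^ 3 - 1) s := by
  unfold effProfileDeriv
  have h := ((((hasDerivAt_id s).pow 2).inv (by simpa using hs))).sub (hasDerivAt_id s)
  convert! h using 1
  · ext; simp
  · simp; field_simp

theorem effProfileDeriv_lt {a b : ℝ} (ha : 0 < a) (hab : a < b) :
    effProfileDeriv b < effProfileDeriv a := by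
  have : 1 / b ^ 2 < 1 / a ^ 2 := by gcongr
  unfold effProfileDeriv; linarith

theorem effProfileDeriv_le {a b : ℝ} (ha : 0 < a) (hab : a ≤ b) :
    effProfileDeriv b ≤ effProfileDeriv a := by
  rcases hab.eq_or_lt with rfl | h
  exacts [le_rfl, (effProfileDeriv_lt ha h).le]

theorem effProfileDeriv_one : effProfileDeriv 1 = 0 := by norm_num [effProfileDeriv]

theorem monotoneOn_effProfile : MonotoneOn effProfile (Ioc 0 1) := by
  refine monotoneOn_of_deriv_nonneg (convex_Ioc 0 1) (fun x hx => ?_) (fun x hx => ?_)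
    (fun x hx => ?_)
  · exact (hasDerivAt_effProfile hx.1.ne').continuousAt.continuousWithinAt
  · rw [interior_Ioc] at hx
    exact (hasDerivAt_effProfile hx.1.ne').differentiableAt.differentiableWithinAt
  · rw [interior_Ioc] at hx
    rw [(hasDerivAt_effProfile hx.1.ne').deriv, ← effProfileDeriv_one]
    exact effProfileDeriv_le hx.1 hx.2.le

theorem antitoneOn_effProfile : AntitoneOn effProfile (Ici 1) := by
  have h0 : ∀ x : ℝ, 1 ≤ x → x ≠ 0 := fun x hx => by positivity
  refine antitoneOn_of_deriv_nonpos (convex_Ici 1) (fun x hx => ?_) (fun x hx => ?_)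
    (fun x hx => ?_)
  · exact (hasDerivAt_effProfile (h0 x hx)).continuousAt.continuousWithinAt
  · rw [interior_Ici] at hx
    exact (hasDerivAt_effProfile (h0 x hx.le)).differentiableAt.differentiableWithinAt
  · rw [interior_Ici] at hx
    rw [(hasDerivAt_effProfile (h0 x hx.le)).deriv, ← effProfileDeriv_one]
    exact effProfileDeriv_le one_pos hx.le

theorem effProfile_one_sub_le {r ρ : ℝ} (hr : r ∈ Ioo (0 : ℝ) 1) (h1 : 1 - r ≤ ρ)
    (h2 : ρ ≤ 1 + r) : effProfile (1 - r) ≤ effProfile ρ := by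
  obtain ⟨hr0, hr1⟩ := hr
  rcases le_total ρ 1 with h | h
  · exact monotoneOn_effProfile ⟨by linarith, by linarith⟩ ⟨by linarith, h⟩ h1
  · refine le_trans ?_ (antitoneOn_effProfile h (by simpa using hr0.le) h2)
    have ha : 0 < 1 - r := by linarith
    have hb : 0 < 1 + r := by linarith
    have key : effProfile (1 + r) - effProfile (1 - r) = 2 * r ^ 3 / ((1 - r) * (1 + r)) := by
      unfold effProfile; field_simp; ring
    have : 0 ≤ 2 * r ^ 3 / ((1 - r) * (1 + r)) := by positivity
    linarith

theorem neg_effProfileDeriv_one_sub_le {r ρ : ℝ} (hr : r ∈ Ioo (0 : ℝ) 1) (h1 : 1 - r ≤ ρ)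
    (h2 : ρ ≤ 1 + r) :
    -effProfileDeriv (1 - r) ≤ effProfileDeriv ρ * ((r ^ 2 + ρ ^ 2 - 1) / (2 * ρ * r)) := by
  obtain ⟨hr0, hr1⟩ := hr
  have hρ : 0 < ρ := by linarith
  set k := (r ^ 2 + ρ ^ 2 - 1) / (2 * ρ * r) with hk
  have hk1 : k ≤ 1 := by
    rw [hk, div_le_one (by positivity)]; nlinarith
  have hk2 : -1 ≤ k := by
    rw [hk, le_div_iff₀ (by positivity)]; nlinarith
  rcases le_total ρ 1 with h | h
  · have h3 : effProfileDeriv ρ ≤ effProfileDeriv (1 - r) :=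
      effProfileDeriv_le (by linarith) h1
    have h4 : 0 ≤ effProfileDeriv ρ := effProfileDeriv_one ▸ effProfileDeriv_le hρ h
    nlinarith
  · have h3 : effProfileDeriv (1 + r) ≤ effProfileDeriv ρ := effProfileDeriv_le hρ h2
    have h4 : effProfileDeriv ρ ≤ 0 := effProfileDeriv_one ▸ effProfileDeriv_le one_pos h
    have h5 : 0 ≤ effProfileDeriv (1 - r) + effProfileDeriv (1 + r) := by
      have ha : 0 < 1 - r := by linarith
      have hb : 0 < 1 + r := by linarith
      have : effProfileDeriv (1 - r) + effProfileDeriv (1 + r)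
          = 2 * r ^ 2 * (3 - r ^ 2) / ((1 - r) ^ 2 * (1 + r) ^ 2) := by
        unfold effProfileDeriv; field_simp; ring
      rw [this]
      have : 0 ≤ 3 - r ^ 2 := by nlinarith
      positivity
    nlinarith

/-- `l` is the distance from the primary of mass `1 - μ` to the first Lagrange point. -/
def IsLagrangeDist (μ l : ℝ) : Prop :=
  l ∈ Ioo (0 : ℝ) 1 ∧ (1 - μ) * effProfileDeriv l = μ * effProfileDeriv (1 - l)

theorem exists_isLagrangeDist {μ : ℝ} (hμ : μ ∈ Ioo (0 : ℝ) 1) : ∃ l, IsLagrangeDist μ l := by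
  have hf : ContinuousOn (fun l : ℝ => (1 - μ) * (1 - l ^ 3) * (1 - l) ^ 2
      - μ * (1 - (1 - l) ^ 3) * l ^ 2) (Icc 0 1) := by fun_prop
  obtain ⟨l, hl, h⟩ := intermediate_value_Ioo' zero_le_one hf
    (show (0 : ℝ) ∈ Ioo _ _ by simp [hμ.1, hμ.2])
  refine ⟨l, hl, ?_⟩
  have h1 : l ≠ 0 := hl.1.ne'
  have h2 : 1 - l ≠ 0 := (sub_pos.2 hl.2).ne'
  unfold effProfileDeriv
  field_simp
  simp only at h
  linarith

theorem IsLagrangeDist.symm {μ l : ℝ} (h : IsLagrangeDist μ l) :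
    IsLagrangeDist (1 - μ) (1 - l) := by
  obtain ⟨⟨h0, h1⟩, h2⟩ := h
  exact ⟨⟨by linarith, by linarith⟩, by rw [sub_sub_cancel, sub_sub_cancel, h2]⟩

theorem IsLagrangeDist.axis_pos {μ l r : ℝ} (h : IsLagrangeDist μ l) (hμ : μ ∈ Ioo (0 : ℝ) 1)
    (hr : 0 < r) (hrl : r < l) :
    0 < (1 - μ) * effProfileDeriv r - μ * effProfileDeriv (1 - r) := by
  obtain ⟨⟨h0, h1⟩, h2⟩ := h
  have h3 := effProfileDeriv_lt hr hrl
  have h4 := effProfileDeriv_lt (a := 1 - l) (b := 1 - r) (by linarith) (by linarith)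
  nlinarith [hμ.1, hμ.2]

theorem IsLagrangeDist.effRadialDeriv_ge {μ l r ρ : ℝ} (h : IsLagrangeDist μ l)
    (hμ : μ ∈ Ioo (0 : ℝ) 1) (hr : 0 < r) (hrl : r ≤ l) (h1 : 1 - r ≤ ρ) (h2 : ρ ≤ 1 + r) :
    (1 - μ) * effProfileDeriv r - μ * effProfileDeriv (1 - r) ≤ effRadialDeriv μ r ρ := by
  have := neg_effProfileDeriv_one_sub_le ⟨hr, hrl.trans_lt h.1.2⟩ h1 h2
  unfold effRadialDeriv
  nlinarith [hμ.1]

theorem IsLagrangeDist.effRadialDeriv_pos {μ l r ρ : ℝ} (h : IsLagrangeDist μ l)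
    (hμ : μ ∈ Ioo (0 : ℝ) 1) (hr : 0 < r) (hrl : r < l) (h1 : 1 - r ≤ ρ) (h2 : ρ ≤ 1 + r) :
    0 < effRadialDeriv μ r ρ :=
  (h.axis_pos hμ hr hrl).trans_le (h.effRadialDeriv_ge hμ hr hrl.le h1 h2)

theorem effPotential_axis_le {μ r ρ : ℝ} (hμ : μ ∈ Ioo (0 : ℝ) 1) (hr : r ∈ Ioo (0 : ℝ) 1)
    (h1 : 1 - r ≤ ρ) (h2 : ρ ≤ 1 + r) : effPotential μ r (1 - r) ≤ effPotential μ r ρ := by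
  have := effProfile_one_sub_le hr h1 h2
  unfold effPotential
  nlinarith [hμ.1]

theorem IsLagrangeDist.axis_energy_lt {μ l r : ℝ} (h : IsLagrangeDist μ l)
    (hμ : μ ∈ Ioo (0 : ℝ) 1) (hr : 0 < r) (hrl : r < l) :
    effPotential μ l (1 - l) <
      ((1 - μ) * effProfileDeriv r - μ * effProfileDeriv (1 - r)) ^ 2 / 2
        + effPotential μ r (1 - r) := by
  have hd : ∀ s ∈ Icc r l, HasDerivAt
      (fun s => ((1 - μ) * effProfileDeriv s - μ * effProfileDeriv (1 - s)) ^ 2 / 2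
        + effPotential μ s (1 - s))
      (((1 - μ) * effProfileDeriv s - μ * effProfileDeriv (1 - s)) *
        (-(1 - μ) * (2 / s ^ 3) - μ * (2 / (1 - s) ^ 3))) s := by
    intro s hs
    have hs0 : s ≠ 0 := (hr.trans_le hs.1).ne'
    have hs1 : 1 - s ≠ 0 := by have := hs.2.trans_lt h.1.2; linarith
    have hsub : HasDerivAt (fun s : ℝ => 1 - s) (-1) s := by
      simpa using (hasDerivAt_id s).const_sub 1
    have e1 := ((hasDerivAt_effProfileDeriv hs0).const_mul (1 - μ)).sub
      (((hasDerivAt_effProfileDeriv hs1).comp s hsub).const_mul μ)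
    have e2 := (((hasDerivAt_effProfile hs0).const_mul (1 - μ)).add
      (((hasDerivAt_effProfile hs1).comp s hsub).const_mul μ)).add_const (μ * (1 - μ) / 2)
    have e3 := ((e1.pow 2).div_const 2).add e2
    convert! e3 using 1
    simp
    ring
  have hanti := strictAntiOn_of_deriv_neg (convex_Icc r l)
    (fun s hs => (hd s hs).continuousAt.continuousWithinAt) (fun s hs => by
      rw [interior_Icc] at hs
      rw [(hd s (Ioo_subset_Icc_self hs)).deriv]
      have hs0 : 0 < s := hr.trans hs.1
      have hs1 : 0 < 1 - s := by linarith [hs.2, h.1.2]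
      have h1 := h.axis_pos hμ hs0 hs.2
      have h2 : 0 < 1 - μ := sub_pos.2 hμ.2
      have h3 : 0 < μ := hμ.1
      have h4 : 0 < (1 - μ) * (2 / s ^ 3) + μ * (2 / (1 - s) ^ 3) := by positivity
      nlinarith)
  have := hanti (left_mem_Icc.2 hrl.le) (right_mem_Icc.2 hrl.le) hrl
  simpa [h.2] using this

theorem IsLagrangeDist.energy_lt {μ l r ρ : ℝ} (h : IsLagrangeDist μ l)
    (hμ : μ ∈ Ioo (0 : ℝ) 1) (hr : 0 < r) (hrl : r < l) (h1 : 1 - r ≤ ρ) (h2 : ρ ≤ 1 + r) :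
    effPotential μ l (1 - l) < effRadialDeriv μ r ρ ^ 2 / 2 + effPotential μ r ρ := by
  have h3 := h.axis_energy_lt hμ hr hrl
  have h4 := h.axis_pos hμ hr hrl
  have h5 := h.effRadialDeriv_ge hμ hr hrl.le h1 h2
  have h6 := effPotential_axis_le hμ ⟨hr, hrl.trans h.1.2⟩ h1 h2
  nlinarith

theorem fderiv_apply_of_hasDerivAt_line {f : V4 → ℝ} {x v : V4} {d : ℝ}
    (hf : DifferentiableAt ℝ f x) (h : HasDerivAt (fun t : ℝ => f (x + t • v)) d 0) :
    fderiv ℝ f x v = d := by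
  have hl : HasDerivAt (fun t : ℝ => x + t • v) v 0 := by
    simpa using ((hasDerivAt_id (0 : ℝ)).smul_const v).const_add x
  have h0 : HasFDerivAt f (fderiv ℝ f x) (x + (0 : ℝ) • v) := by simpa using hf.hasFDerivAt
  exact (h0.comp_hasDerivAt 0 hl).unique h

theorem sq_add_sq_pos_of_ne {a b : ℝ} (h : ¬(a = 0 ∧ b = 0)) : 0 < a ^ 2 + b ^ 2 := by
  by_contra! h0
  exact h ⟨by nlinarith [sq_nonneg a, sq_nonneg b], by nlinarith [sq_nonneg a, sq_nonneg b]⟩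

theorem JacobiDom.radii_pos {μ : ℝ} {x : V4} (hx : x ∈ JacobiDom μ) :
    0 < (x 0 + μ) ^ 2 + x 1 ^ 2 ∧ 0 < (x 0 - (1 - μ)) ^ 2 + x 1 ^ 2 := by
  obtain ⟨h1, h2⟩ := hx
  simp only [ne_eq, Prod.mk.injEq] at h1 h2
  constructor
  · exact sq_add_sq_pos_of_ne fun h => h1 ⟨by linarith [h.1], h.2⟩
  · exact sq_add_sq_pos_of_ne fun h => h2 ⟨by linarith [h.1], h.2⟩

theorem fderiv_JacobiH_apply {μ : ℝ} {x : V4} (hx : x ∈ JacobiDom μ) (v : V4) :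
    fderiv ℝ (JacobiH μ) x v =
      x 2 * v 2 + x 3 * v 3 + (v 0 * x 3 + x 0 * v 3) - (v 1 * x 2 + x 1 * v 2)
      + (1 - μ) * ((x 0 + μ) * v 0 + x 1 * v 1) / √((x 0 + μ) ^ 2 + x 1 ^ 2) ^ 3
      + μ * ((x 0 - (1 - μ)) * v 0 + x 1 * v 1) / √((x 0 - (1 - μ)) ^ 2 + x 1 ^ 2) ^ 3 := by
  obtain ⟨h1, h2⟩ := JacobiDom.radii_pos hx
  have hdiff : DifferentiableAt ℝ (JacobiH μ) x := by
    have s1 := (Real.sqrt_pos.2 h1).ne'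
    have s2 := (Real.sqrt_pos.2 h2).ne'
    unfold JacobiH
    fun_prop (disch := first | assumption | exact h1.ne' | exact h2.ne')
  refine fderiv_apply_of_hasDerivAt_line hdiff ?_
  have hc : ∀ i, HasDerivAt (fun t : ℝ => x i + t * v i) (v i) 0 := fun i => by
    simpa using ((hasDerivAt_id (0 : ℝ)).mul_const (v i)).const_add (x i)
  have hs : ∀ k : ℝ, 0 < (x 0 + k) ^ 2 + x 1 ^ 2 →
      HasDerivAt (fun t : ℝ => √((x 0 + t * v 0 + k) ^ 2 + (x 1 + t * v 1) ^ 2))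
        (((x 0 + k) * v 0 + x 1 * v 1) / √((x 0 + k) ^ 2 + x 1 ^ 2)) 0 := fun k hk => by
    have := ((((hc 0).add_const k).pow 2).add ((hc 1).pow 2)).sqrt (by simpa using hk.ne')
    convert! this using 1
    have := (Real.sqrt_pos.2 hk).ne'
    simp
    field_simp
  have e1 := hs μ h1
  have e2 := hs (-(1 - μ)) (by simpa [sub_eq_add_neg] using h2)
  have p1 := Real.sqrt_pos.2 h1
  have p2 := Real.sqrt_pos.2 h2
  have key := (((((((hc 2).pow 2).add ((hc 3).pow 2)).const_mul (1 / 2)).add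
    ((hc 0).mul (hc 3))).sub ((hc 1).mul (hc 2))).sub
    ((e1.inv (by simpa using p1.ne')).const_mul (1 - μ))).sub
    ((e2.inv (by simpa [sub_eq_add_neg] using p2.ne')).const_mul μ)
  simp only [← sub_eq_add_neg] at key
  convert! key using 1
  simp
  field_simp
  ring

theorem abs_sub_le_of_sq {r ρ d : ℝ} (hr : 0 ≤ r) (hρ : 0 ≤ ρ) (hd : d ^ 2 ≤ r ^ 2)
    (h : ρ ^ 2 = r ^ 2 - 2 * d + 1) : 1 - r ≤ ρ ∧ ρ ≤ 1 + r ∧ 1 - ρ ≤ r ∧ r ≤ 1 + ρ := by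
  obtain ⟨h1, h2⟩ := abs_le_of_sq_le_sq' hd hr
  refine ⟨?_, ?_, ?_, ?_⟩
  · by_contra! h'; nlinarith
  · by_contra! h'; nlinarith
  · by_contra! h'; nlinarith
  · by_contra! h'; nlinarith

theorem mul_effRadialDeriv {μ r ρ : ℝ} (hr : 0 < r) (hρ : 0 < ρ) :
    r ^ 2 * effRadialDeriv μ r ρ = (1 - μ) * (1 - r ^ 3)
      + μ * (1 - ρ ^ 3) * r * (r ^ 2 + ρ ^ 2 - 1) / (2 * ρ ^ 3) := by
  unfold effRadialDeriv effProfileDeriv; field_simp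

theorem effRadialDeriv_neg {μ r ρ : ℝ} (hμ : μ ∈ Ioo (0 : ℝ) 1) (hr : 2 ≤ r) (hρ : 1 ≤ ρ) :
    effRadialDeriv μ r ρ < 0 := by
  have h1 : effProfileDeriv r < 0 :=
    effProfileDeriv_one ▸ effProfileDeriv_lt one_pos (by linarith)
  have h2 : effProfileDeriv ρ ≤ 0 := effProfileDeriv_one ▸ effProfileDeriv_le one_pos hρ
  have h3 : 0 ≤ (r ^ 2 + ρ ^ 2 - 1) / (2 * ρ * r) := by
    apply div_nonneg <;> nlinarith
  unfold effRadialDeriv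
  have := mul_nonpos_of_nonpos_of_nonneg h2 h3
  nlinarith [hμ.1, hμ.2]

/-- At a critical point the energy is the effective potential, whose derivatives in the directions
away from both primaries vanish. -/
theorem JacobiH_critical {μ : ℝ} {x : V4} (hx : x ∈ JacobiDom μ)
    (h : fderiv ℝ (JacobiH μ) x = 0) :
    ∃ r ρ, 0 < r ∧ 0 < ρ ∧ 1 - r ≤ ρ ∧ ρ ≤ 1 + r ∧ 1 - ρ ≤ r ∧ r ≤ 1 + ρ ∧ effRadialDeriv μ r ρ = 0 ∧
      effRadialDeriv (1 - μ) ρ r = 0 ∧ JacobiH μ x = effPotential μ r ρ := by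
  obtain ⟨h1, h2⟩ := JacobiDom.radii_pos hx
  have hv : ∀ v, fderiv ℝ (JacobiH μ) x v = 0 := fun v => by rw [h]; rfl
  simp only [fderiv_JacobiH_apply hx] at hv
  have d2 := hv ![0, 0, 1, 0]
  have d3 := hv ![0, 0, 0, 1]
  have dr := hv ![x 0 + μ, x 1, 0, 0]
  have dρ := hv ![x 0 - (1 - μ), x 1, 0, 0]
  have er := Real.sq_sqrt h1.le
  have eρ := Real.sq_sqrt h2.le
  have pr := Real.sqrt_pos.2 h1
  have pρ := Real.sqrt_pos.2 h2
  have eH : JacobiH μ x = (1 / 2) * (x 2 ^ 2 + x 3 ^ 2) + x 0 * x 3 - x 1 * x 2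
    - (1 - μ) / √((x 0 + μ) ^ 2 + x 1 ^ 2) - μ / √((x 0 - (1 - μ)) ^ 2 + x 1 ^ 2) := rfl
  generalize √((x 0 + μ) ^ 2 + x 1 ^ 2) = r at *
  generalize √((x 0 - (1 - μ)) ^ 2 + x 1 ^ 2) = ρ at *
  simp at d2 d3 dr dρ
  have e2 : x 2 = x 1 := by linarith
  have e3 : x 3 = -x 0 := by linarith
  have tri := abs_sub_le_of_sq (d := x 0 + μ) pr.le pρ.le (by nlinarith [sq_nonneg (x 1)])
    (by rw [er, eρ]; ring)
  refine ⟨r, ρ, pr, pρ, tri.1, tri.2.1, tri.2.2.1, tri.2.2.2, ?_, ?_, ?_⟩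
  · have := mul_effRadialDeriv (μ := μ) pr pρ
    rw [e2, e3] at dr
    have hx0 : x 0 = (r ^ 2 - ρ ^ 2 + 1) / 2 - μ := by linarith
    have hx1 : x 1 ^ 2 = r ^ 2 - (x 0 + μ) ^ 2 := by linarith
    have : r ^ 2 * effRadialDeriv μ r ρ = 0 := by
      rw [this, ← mul_zero r, ← dr]
      rw [show (x 0 + μ) * -x 0 - x 1 * x 1 = -(x 0 + μ) * x 0 - x 1 ^ 2 by ring,
        show (x 0 + μ) * (x 0 + μ) + x 1 * x 1 = r ^ 2 by rw [er]; ring,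
        show (x 0 - (1 - μ)) * (x 0 + μ) + x 1 * x 1 = r ^ 2 - (x 0 + μ) by rw [er]; ring,
        hx1, hx0]
      field_simp
      ring
    exact (mul_eq_zero.1 this).resolve_left (by positivity)
  · have := mul_effRadialDeriv (μ := 1 - μ) pρ pr
    rw [e2, e3] at dρ
    have hx0 : x 0 = (r ^ 2 - ρ ^ 2 + 1) / 2 - μ := by linarith
    have hx1 : x 1 ^ 2 = r ^ 2 - (x 0 + μ) ^ 2 := by linarith
    have : ρ ^ 2 * effRadialDeriv (1 - μ) ρ r = 0 := by
      rw [this, ← mul_zero ρ, ← dρ]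
      rw [show (x 0 - (1 - μ)) * -x 0 - x 1 * x 1 = -(x 0 - (1 - μ)) * x 0 - x 1 ^ 2 by ring,
        show (x 0 - (1 - μ)) * (x 0 - (1 - μ)) + x 1 * x 1 = ρ ^ 2 by rw [eρ]; ring,
        show (x 0 + μ) * (x 0 - (1 - μ)) + x 1 * x 1 = r ^ 2 - (x 0 + μ) by rw [er]; ring,
        hx1, hx0]
      field_simp
      ring
    exact (mul_eq_zero.1 this).resolve_left (by positivity)
  · rw [eH, e2, e3]
    have hx0 : x 0 = (r ^ 2 - ρ ^ 2 + 1) / 2 - μ := by linarith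
    have hx1 : x 1 ^ 2 = r ^ 2 - (x 0 + μ) ^ 2 := by linarith
    rw [show (1 / 2) * (x 1 ^ 2 + (-x 0) ^ 2) + x 0 * -x 0 - x 1 * x 1
      = -(1 / 2) * (x 1 ^ 2 + x 0 ^ 2) by ring, hx1, hx0]
    unfold effPotential effProfile
    ring

theorem IsLagrangeDist.le_of_critical {μ l r ρ : ℝ} (h : IsLagrangeDist μ l)
    (hμ : μ ∈ Ioo (0 : ℝ) 1) (hr : 0 < r) (h1 : 1 - r ≤ ρ) (h2 : ρ ≤ 1 + r)
    (h0 : effRadialDeriv μ r ρ = 0) : l ≤ r := by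
  by_contra! hlt
  exact (h.effRadialDeriv_pos hμ hr hlt h1 h2).ne' h0

theorem bddBelow_JacobiCritVals {μ : ℝ} (hμ : μ ∈ Ioo (0 : ℝ) 1) :
    BddBelow (JacobiCritVals μ) := by
  obtain ⟨l, hl⟩ := exists_isLagrangeDist hμ
  have hμ' : 1 - μ ∈ Ioo (0 : ℝ) 1 := ⟨by linarith [hμ.2], by linarith [hμ.1]⟩
  have hl0 := hl.1.1
  have hl1 := hl.symm.1.1
  refine ⟨(1 - μ) * (-9 / 2 - 1 / l) + μ * (-9 / 2 - 1 / (1 - l)) + μ * (1 - μ) / 2, ?_⟩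
  rintro _ ⟨x, hx, hd, rfl⟩
  obtain ⟨r, ρ, pr, pρ, t1, t2, t3, t4, c1, c2, hH⟩ := JacobiH_critical hx hd
  have b1 := hl.le_of_critical hμ pr t1 t2 c1
  have b2 := hl.symm.le_of_critical hμ' pρ t3 t4 c2
  have b3 : r < 2 := by
    by_contra! hr
    exact (effRadialDeriv_neg hμ hr (by linarith)).ne c1
  have e1 : -9 / 2 - 1 / l ≤ effProfile r := by
    have : 1 / r ≤ 1 / l := by gcongr
    unfold effProfile; nlinarith
  have e2 : -9 / 2 - 1 / (1 - l) ≤ effProfile ρ := by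
    have : 1 / ρ ≤ 1 / (1 - l) := by gcongr
    unfold effProfile; nlinarith
  rw [hH]
  unfold effPotential
  nlinarith [hμ'.1, hμ.1]

theorem IsLagrangeDist.mem_JacobiCritVals {μ l : ℝ} (h : IsLagrangeDist μ l) :
    effPotential μ l (1 - l) ∈ JacobiCritVals μ := by
  have h0 := h.1.1
  have h1 := h.symm.1.1
  have s1 : √(l ^ 2) = l := Real.sqrt_sq h0.le
  have s2 : √((l - 1) ^ 2) = 1 - l := by
    rw [← neg_sub, neg_sq]; exact Real.sqrt_sq h1.le
  have hx : ![l - μ, 0, 0, -(l - μ)] ∈ JacobiDom μ := by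
    constructor <;> simp [h0.ne', h.1.2.ne]
  refine ⟨_, hx, ?_, ?_⟩
  · ext v
    rw [fderiv_JacobiH_apply hx]
    have h2 := h.2
    unfold effProfileDeriv at h2
    simp [s2, show l - μ - (1 - μ) = l - 1 by ring, s1]
    have : v 0 * (-l + μ + (1 - μ) / l ^ 2 - μ / (1 - l) ^ 2) = 0 := by
      rw [show -l + μ + (1 - μ) / l ^ 2 - μ / (1 - l) ^ 2 =
        (1 - μ) * (1 / l ^ 2 - l) - μ * (1 / (1 - l) ^ 2 - (1 - l)) by ring, h2]
      ring
    rw [← this]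
    field_simp
    ring
  · unfold JacobiH effPotential effProfile
    simp [s2, show l - μ - (1 - μ) = l - 1 by ring, s1]
    ring

theorem IsLagrangeDist.neg_lt {μ l c : ℝ} (h : IsLagrangeDist μ l) (hμ : μ ∈ Ioo (0 : ℝ) 1)
    (hc : -c < sInf (JacobiCritVals μ)) : -c < effPotential μ l (1 - l) :=
  hc.trans_le (csInf_le (bddBelow_JacobiCritVals hμ) h.mem_JacobiCritVals)

/-- The region of phase space over the disc of radius `l` around the primary of mass `1 - μ`. -/
def LCDisc (l : ℝ) : Set V4 := {x | 2 * (x 0 ^ 2 + x 1 ^ 2) < l}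

theorem isOpen_LCDisc (l : ℝ) : IsOpen (LCDisc l) :=
  isOpen_lt (by fun_prop) continuous_const

theorem sq_lcAbs (a b : ℝ) :
    lcAbs a b ^ 2 = (2 * (a ^ 2 + b ^ 2)) ^ 2 - 2 * (2 * (a ^ 2 - b ^ 2)) + 1 := by
  unfold lcAbs
  rw [Real.sq_sqrt (by positivity)]
  ring

theorem lcAbs_bounds (a b : ℝ) :
    1 - 2 * (a ^ 2 + b ^ 2) ≤ lcAbs a b ∧ lcAbs a b ≤ 1 + 2 * (a ^ 2 + b ^ 2) := by
  have := abs_sub_le_of_sq (r := 2 * (a ^ 2 + b ^ 2)) (ρ := lcAbs a b)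
    (d := 2 * (a ^ 2 - b ^ 2)) (by positivity) (Real.sqrt_nonneg _)
    (by nlinarith [sq_nonneg (a * b)]) (sq_lcAbs a b)
  exact ⟨this.1, this.2.1⟩

theorem lcAbs_pos {a b : ℝ} (h : 2 * (a ^ 2 + b ^ 2) < 1) : 0 < lcAbs a b := by
  linarith [(lcAbs_bounds a b).1]

theorem Kham_eq (μ c : ℝ) {x : V4} (hB : 0 < x 0 ^ 2 + x 1 ^ 2) (hρ : 0 < lcAbs (x 0) (x 1)) :
    Kham μ c x = ((x 2 - (2 * (x 0 ^ 2 + x 1 ^ 2) + μ) * x 1) ^ 2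
        + (x 3 + (2 * (x 0 ^ 2 + x 1 ^ 2) - μ) * x 0) ^ 2) / 2
      + (x 0 ^ 2 + x 1 ^ 2) * (c + effPotential μ (2 * (x 0 ^ 2 + x 1 ^ 2)) (lcAbs (x 0) (x 1))) := by
  have h := sq_lcAbs (x 0) (x 1)
  unfold Kham effPotential effProfile
  rw [neg_div, neg_div, h]
  field_simp
  ring

theorem IsLagrangeDist.Kham_pos {μ l c : ℝ} (h : IsLagrangeDist μ l) (hμ : μ ∈ Ioo (0 : ℝ) 1)
    (hc : -c < effPotential μ l (1 - l)) {x : V4} (hx : 2 * (x 0 ^ 2 + x 1 ^ 2) = l) :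
    0 < Kham μ c x := by
  have hb := lcAbs_bounds (x 0) (x 1)
  have hB : 0 < x 0 ^ 2 + x 1 ^ 2 := by linarith [h.1.1]
  rw [Kham_eq μ c hB (lcAbs_pos (hx ▸ h.1.2)), hx]
  rw [hx] at hb
  have := effPotential_axis_le hμ h.1 hb.1 hb.2
  have h1 : 0 < c + effPotential μ l (lcAbs (x 0) (x 1)) := by linarith
  positivity

theorem contDiffAt_Kham (μ c : ℝ) {x : V4} (hx : x ∈ LCDom) :
    ContDiffAt ℝ (⊤ : ℕ∞) (Kham μ c) x := by
  have hx' : lcAbs (x 0) (x 1) ≠ 0 := hx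
  have hs : (2 * (x 0 ^ 2 - x 1 ^ 2) - 1) ^ 2 + (4 * x 0 * x 1) ^ 2 ≠ 0 := fun h0 => hx' (by
    unfold lcAbs; rw [h0, Real.sqrt_zero])
  have hl : ContDiffAt ℝ (⊤ : ℕ∞) (fun y : V4 => lcAbs (y 0) (y 1)) x := by
    unfold lcAbs
    exact ContDiffAt.sqrt (by fun_prop) hs
  unfold Kham
  have hd : ContDiffAt ℝ (⊤ : ℕ∞) (fun y : V4 =>
      μ * ((y 0) ^ 2 + (y 1) ^ 2) / lcAbs (y 0) (y 1)) x :=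
    ContDiffAt.div (by fun_prop) hl hx'
  exact ContDiffAt.sub (by fun_prop) hd

theorem differentiableAt_Kham (μ c : ℝ) {x : V4} (hx : x ∈ LCDom) :
    DifferentiableAt ℝ (Kham μ c) x :=
  (contDiffAt_Kham μ c hx).differentiableAt (by simp)

theorem fderiv_Kham_self (μ c : ℝ) {x : V4} (hx : x ∈ LCDom) :
    fderiv ℝ (Kham μ c) x x = 2 * Kham μ c x + (1 - μ)
      + 4 * (x 0 ^ 2 + x 1 ^ 2) * (x 0 * x 3 - x 1 * x 2)
      + 4 * μ * (x 0 ^ 2 + x 1 ^ 2) * (2 * (x 0 ^ 2 + x 1 ^ 2) ^ 2 - (x 0 ^ 2 - x 1 ^ 2))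
        / lcAbs (x 0) (x 1) ^ 3 := by
  refine fderiv_apply_of_hasDerivAt_line (differentiableAt_Kham μ c hx) ?_
  have hx' : lcAbs (x 0) (x 1) ≠ 0 := hx
  have hc : ∀ i, HasDerivAt (fun t : ℝ => x i + t * x i) (x i) 0 := fun i => by
    simpa using ((hasDerivAt_id (0 : ℝ)).mul_const (x i)).const_add (x i)
  have hs : (2 * (x 0 ^ 2 - x 1 ^ 2) - 1) ^ 2 + (4 * x 0 * x 1) ^ 2 ≠ 0 := fun h0 => hx' (by
    unfold lcAbs; rw [h0, Real.sqrt_zero])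
  have hl : HasDerivAt (fun t : ℝ => lcAbs (x 0 + t * x 0) (x 1 + t * x 1))
      ((8 * (x 0 ^ 2 + x 1 ^ 2) ^ 2 - 4 * (x 0 ^ 2 - x 1 ^ 2)) / lcAbs (x 0) (x 1)) 0 := by
    have := (((((((hc 0).pow 2).sub ((hc 1).pow 2)).const_mul 2).sub_const 1).pow 2).add
      ((((hc 0).const_mul 4).mul (hc 1)).pow 2)).sqrt (by simpa using hs)
    convert! this using 1
    rw [← mul_div_mul_left _ _ (two_ne_zero' ℝ)]
    simp [lcAbs]
    congr 1
    ring
  have hq : ∀ p q s : ℝ, (p * lcAbs (x 0) (x 1) - q * (s / lcAbs (x 0) (x 1)))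
      / lcAbs (x 0) (x 1) ^ 2 = p / lcAbs (x 0) (x 1) - q * s / lcAbs (x 0) (x 1) ^ 3 := by
    intro p q s
    field_simp
  have hB := ((hc 0).pow 2).add ((hc 1).pow 2)
  have key := ((((((((hc 2).pow 2).add ((hc 3).pow 2)).const_mul (1 / 2)).add
    (hB.const_mul c)).sub_const ((1 - μ) / 2)).add
    ((hB.const_mul 2).mul (((hc 0).mul (hc 3)).sub ((hc 1).mul (hc 2))))).sub
    ((((hc 0).mul (hc 3)).add ((hc 1).mul (hc 2))).const_mul μ)).sub
    ((hB.const_mul μ).div hl (by simpa using hx'))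
  convert! key using 1
  simp [Kham]
  rw [hq]
  ring

theorem radial_sum_pos {a b u v D : ℝ} (hB : 0 < a ^ 2 + b ^ 2) (hD : 0 < D)
    (h : u ^ 2 + v ^ 2 < (a ^ 2 + b ^ 2) * D ^ 2) :
    0 < (2 * (a ^ 2 + b ^ 2)) ^ 2 * D + 4 * (a ^ 2 + b ^ 2) * (a * v - b * u) := by
  have hcs : (a * v - b * u) ^ 2 < ((a ^ 2 + b ^ 2) * D) ^ 2 :=
    calc (a * v - b * u) ^ 2 ≤ (a ^ 2 + b ^ 2) * (u ^ 2 + v ^ 2) := by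
          nlinarith [sq_nonneg (a * u + b * v)]
      _ < (a ^ 2 + b ^ 2) * ((a ^ 2 + b ^ 2) * D ^ 2) := by gcongr
      _ = ((a ^ 2 + b ^ 2) * D) ^ 2 := by ring
  have := (abs_lt_of_sq_lt_sq' hcs (by positivity)).1
  calc 0 < 4 * (a ^ 2 + b ^ 2) * ((a ^ 2 + b ^ 2) * D + (a * v - b * u)) :=
        mul_pos (by positivity) (by linarith)
    _ = _ := by ring

theorem IsLagrangeDist.fderiv_Kham_self_pos {μ l c : ℝ} (h : IsLagrangeDist μ l)
    (hμ : μ ∈ Ioo (0 : ℝ) 1) (hc : -c < effPotential μ l (1 - l)) {x : V4} (hx : x ∈ LCDisc l)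
    (hK : Kham μ c x = 0) : 0 < fderiv ℝ (Kham μ c) x x := by
  have hx' : 2 * (x 0 ^ 2 + x 1 ^ 2) < l := hx
  have hρ : 0 < lcAbs (x 0) (x 1) := lcAbs_pos (hx'.trans h.1.2)
  rw [fderiv_Kham_self μ c hρ.ne', hK]
  rcases (add_nonneg (sq_nonneg (x 0)) (sq_nonneg (x 1))).eq_or_lt with hB | hB
  · rw [← hB]; simpa using hμ.2
  rw [Kham_eq μ c hB hρ] at hK
  have hb := lcAbs_bounds (x 0) (x 1)
  have hρ2 := sq_lcAbs (x 0) (x 1)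
  have hr : 0 < 2 * (x 0 ^ 2 + x 1 ^ 2) := by positivity
  have hpos := h.effRadialDeriv_pos hμ hr hx' hb.1 hb.2
  have hen := h.energy_lt hμ hr hx' hb.1 hb.2
  have hmul := mul_effRadialDeriv (μ := μ) hr hρ
  set ρ := lcAbs (x 0) (x 1)
  set B := x 0 ^ 2 + x 1 ^ 2 with hBdef
  set D := effRadialDeriv μ (2 * B) ρ
  set U := effPotential μ (2 * B) ρ
  set V2 := x 2 - (2 * B + μ) * x 1 with hV2
  set V3 := x 3 + (2 * B - μ) * x 0 with hV3
  have hL : x 0 * x 3 - x 1 * x 2 = (x 0 * V3 - x 1 * V2) - 2 * B ^ 2 + μ * (x 0 ^ 2 - x 1 ^ 2) := by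
    rw [hV2, hV3, hBdef]; ring
  have ha : x 0 ^ 2 - x 1 ^ 2 = ((2 * B) ^ 2 + 1 - ρ ^ 2) / 4 := by linarith
  have hgoal : 2 * 0 + (1 - μ) + 4 * B * (x 0 * x 3 - x 1 * x 2)
      + 4 * μ * B * (2 * B ^ 2 - (x 0 ^ 2 - x 1 ^ 2)) / ρ ^ 3
      = (2 * B) ^ 2 * D + 4 * B * (x 0 * V3 - x 1 * V2) := by
    rw [hmul, hL, ha]; field_simp; ring
  rw [hgoal]
  have hV := mul_lt_mul_of_pos_left (show -(D ^ 2 / 2) < c + U by linarith) hB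
  exact radial_sum_pos hB hpos (by linarith)

section Starshaped

variable {E : Type*} [NormedAddCommGroup E] [NormedSpace ℝ E]

/-- The zero set of `K` in `Ω` meets every open ray from the origin, transversally, and `Ω` is
starshaped. -/
structure IsRadiallyTransverse (K : E → ℝ) (Ω : Set E) : Prop where
  isOpen : IsOpen Ω
  smul_mem : ∀ x ∈ Ω, ∀ s ∈ Icc (0 : ℝ) 1, s • x ∈ Ω
  contDiffAt : ∀ x ∈ Ω, ContDiffAt ℝ (⊤ : ℕ∞) K x
  radial_pos : ∀ x ∈ Ω, K x = 0 → 0 < fderiv ℝ K x x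
  exists_zero : ∀ x, x ≠ 0 → ∃ t : ℝ, 0 < t ∧ t • x ∈ Ω ∧ K (t • x) = 0

namespace IsRadiallyTransverse

variable {K : E → ℝ} {Ω : Set E}

theorem fderiv_pos (h : IsRadiallyTransverse K Ω) {x : E} {t : ℝ} (ht : 0 < t)
    (hx : t • x ∈ Ω) (hK : K (t • x) = 0) : 0 < fderiv ℝ K (t • x) x := by
  have := h.radial_pos _ hx hK
  rw [map_smul, smul_eq_mul] at this
  exact pos_of_mul_pos_right this ht.le

theorem hasDerivAt (h : IsRadiallyTransverse K Ω) {x : E} {t : ℝ} (hx : t • x ∈ Ω) :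
    HasDerivAt (fun s : ℝ => K (s • x)) (fderiv ℝ K (t • x) x) t := by
  have hl : HasDerivAt (fun s : ℝ => s • x) x t := by
    simpa using (hasDerivAt_id t).smul_const x
  exact ((h.contDiffAt _ hx).differentiableAt (by simp)).hasFDerivAt.comp_hasDerivAt t hl

theorem zero_not_lt_zero (h : IsRadiallyTransverse K Ω) {x : E} {a b : ℝ} (ha : 0 < a)
    (haK : K (a • x) = 0) (hb : b • x ∈ Ω) (hbK : K (b • x) = 0) : ¬a < b := by
  intro hab
  have hmem : ∀ s ∈ Icc a b, s • x ∈ Ω := by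
    intro s hs
    have hb0 : 0 < b := ha.trans hab
    have := h.smul_mem _ hb (s / b)
      ⟨div_nonneg (ha.le.trans hs.1) hb0.le, (div_le_one hb0).2 hs.2⟩
    rwa [smul_smul, div_mul_cancel₀ _ hb0.ne'] at this
  have hnonneg := image_le_of_deriv_right_lt_deriv_boundary' (f := fun _ => (0 : ℝ))
    (f' := fun _ => 0) (B := fun s => K (s • x)) (a := a) (b := b) continuousOn_const
    (fun s _ => hasDerivWithinAt_const _ _ _) haK.ge
    (fun s hs => (h.hasDerivAt (hmem s hs)).continuousAt.continuousWithinAt)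
    (fun s hs => (h.hasDerivAt (hmem s (Ico_subset_Icc_self hs))).hasDerivWithinAt)
    (fun s hs h0 => h.fderiv_pos (ha.trans_le hs.1) (hmem s (Ico_subset_Icc_self hs)) h0.symm)
  have hpos := h.fderiv_pos (ha.trans hab) hb hbK
  have hslope := (hasDerivAt_iff_tendsto_slope_left_right.1 (h.hasDerivAt hb)).1
  have : fderiv ℝ K (b • x) x ≤ 0 := by
    refine le_of_tendsto hslope ?_
    filter_upwards [Ioo_mem_nhdsLT hab] with s hs
    simp only [slope_def_field, hbK, sub_zero]
    exact div_nonpos_of_nonneg_of_nonpos (hnonneg ⟨hs.1.le, hs.2.le⟩) (by linarith [hs.2])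
  linarith

theorem existsUnique (h : IsRadiallyTransverse K Ω) {x : E} (hx : x ≠ 0) :
    ∃! t : ℝ, 0 < t ∧ t • x ∈ Ω ∧ K (t • x) = 0 := by
  obtain ⟨t, ht0, ht, htK⟩ := h.exists_zero x hx
  refine ⟨t, ⟨ht0, ht, htK⟩, fun s ⟨hs0, hs, hsK⟩ => le_antisymm ?_ ?_⟩
  · exact not_lt.1 (h.zero_not_lt_zero ht0 htK hs hsK)
  · exact not_lt.1 (h.zero_not_lt_zero hs0 hsK ht htK)

theorem exists_radius [CompleteSpace E] (h : IsRadiallyTransverse K Ω) :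
    ∃ τ : E → ℝ, ∀ x, x ≠ 0 → 0 < τ x ∧ τ x • x ∈ Ω ∧ K (τ x • x) = 0 ∧
      (∀ t, 0 < t → t • x ∈ Ω → K (t • x) = 0 → t = τ x) ∧ ContDiffAt ℝ (⊤ : ℕ∞) τ x := by
  have hex : ∀ x : E, ∃ t : ℝ, x ≠ 0 → (0 < t ∧ t • x ∈ Ω ∧ K (t • x) = 0) ∧
      ∀ s, 0 < s → s • x ∈ Ω → K (s • x) = 0 → s = t := by
    intro x
    by_cases hx : x = 0
    · exact ⟨0, fun h => absurd hx h⟩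
    · obtain ⟨t, ht, hu⟩ := h.existsUnique hx
      exact ⟨t, fun _ => ⟨ht, fun s h1 h2 h3 => hu s ⟨h1, h2, h3⟩⟩⟩
  choose τ hτ using hex
  refine ⟨τ, fun x hx => ⟨(hτ x hx).1.1, (hτ x hx).1.2.1, (hτ x hx).1.2.2, (hτ x hx).2, ?_⟩⟩
  obtain ⟨⟨hpos, hmem, hK⟩, -⟩ := hτ x hx
  set f : E × ℝ → ℝ := fun u => K (u.2 • u.1) with hf
  have cdf : ContDiffAt ℝ (⊤ : ℕ∞) f (x, τ x) :=
    ContDiffAt.comp (x, τ x) (g := K) (h.contDiffAt _ hmem) (contDiffAt_snd.smul contDiffAt_fst)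
  have pn : ((⊤ : ℕ∞) : WithTop ℕ∞) ≠ 0 := by simp
  have hd : HasDerivAt (fun t : ℝ => f (x, t))
      ((fderiv ℝ f (x, τ x) ∘L .inr ℝ E ℝ) 1) (τ x) := by
    have := ((cdf.differentiableAt pn).hasFDerivAt.comp (τ x)
      (hasFDerivAt_prodMk_right x (τ x))).hasDerivAt
    exact this
  have hval := hd.unique (h.hasDerivAt hmem)
  have if₂ : (fderiv ℝ f (x, τ x) ∘L .inr ℝ E ℝ).IsInvertible := by
    refine ⟨ContinuousLinearEquiv.unitsEquivAut ℝ (Units.mk0 _ (h.fderiv_pos hpos hmem hK).ne'), ?_⟩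
    ext
    rw [hval]
    simp
  have hself := cdf.implicitFunction_apply_self pn if₂
  have hsmooth := cdf.contDiffAt_implicitFunction pn if₂
  have hzero := cdf.eventually_apply_implicitFunction pn if₂
  simp only at hself hsmooth hzero
  refine hsmooth.congr_of_eventuallyEq ?_
  have hcont := hsmooth.continuousAt
  have e1 := hcont.eventually (lt_mem_nhds (hself.symm ▸ hpos))
  have e2 := (hcont.smul continuousAt_id).eventually
    (h.isOpen.mem_nhds (show cdf.implicitFunction pn if₂ x • x ∈ Ω by rw [hself]; exact hmem))
  filter_upwards [hzero, e1, e2, isOpen_ne.mem_nhds hx] with y h1 h2 h3 h4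
  exact ((hτ y h4).2 _ h2 h3 (h1.trans hK)).symm

end IsRadiallyTransverse

end Starshaped

namespace IsRadiallyTransverse

variable {E : Type*} [NormedAddCommGroup E] [NormedSpace ℝ E] [CompleteSpace E]
  {K : E → ℝ} {Ω : Set E}

theorem zeroSet_eq_image (h : IsRadiallyTransverse K Ω) (h0 : K 0 ≠ 0) :
    ∃ f : E → E, ContinuousOn f (Metric.sphere 0 1) ∧
      f '' Metric.sphere 0 1 = {x | x ∈ Ω ∧ K x = 0} := by
  obtain ⟨τ, hτ⟩ := h.exists_radius
  have hne : ∀ x ∈ Metric.sphere (0 : E) 1, x ≠ 0 := fun x hx =>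
    Metric.ne_of_mem_sphere hx one_ne_zero
  refine ⟨fun x => τ x • x, fun x hx =>
    ((hτ x (hne x hx)).2.2.2.2.continuousAt.smul continuousAt_id).continuousWithinAt, ?_⟩
  ext y
  constructor
  · rintro ⟨x, hx, rfl⟩
    exact ⟨(hτ x (hne x hx)).2.1, (hτ x (hne x hx)).2.2.1⟩
  · rintro ⟨hy, hK⟩
    have hy0 : y ≠ 0 := by rintro rfl; exact h0 hK
    have hn : 0 < ‖y‖ := norm_pos_iff.2 hy0
    have hs : ‖y‖⁻¹ • y ∈ Metric.sphere (0 : E) 1 := by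
      simp [norm_smul, hn.ne']
    have hyy : ‖y‖ • ‖y‖⁻¹ • y = y := by rw [smul_smul, mul_inv_cancel₀ hn.ne', one_smul]
    refine ⟨_, hs, ?_⟩
    dsimp only
    rw [← (hτ _ (hne _ hs)).2.2.2.1 ‖y‖ hn (by rwa [hyy]) (by rwa [hyy]), hyy]

theorem isCompact_zeroSet [ProperSpace E] (h : IsRadiallyTransverse K Ω) (h0 : K 0 ≠ 0) :
    IsCompact {x | x ∈ Ω ∧ K x = 0} := by
  obtain ⟨f, hf, hi⟩ := h.zeroSet_eq_image h0
  exact hi ▸ (isCompact_sphere 0 1).image_of_continuousOn hf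

theorem isPreconnected_zeroSet (h : IsRadiallyTransverse K Ω) (h0 : K 0 ≠ 0)
    (hE : 1 < Module.rank ℝ E) : IsPreconnected {x | x ∈ Ω ∧ K x = 0} := by
  obtain ⟨f, hf, hi⟩ := h.zeroSet_eq_image h0
  exact hi ▸ (isConnected_sphere hE 0 zero_le_one).isPreconnected.image f hf

end IsRadiallyTransverse

/-- The squared Euclidean norm on phase space. -/
def normSq4 (x : V4) : ℝ := x 0 ^ 2 + x 1 ^ 2 + x 2 ^ 2 + x 3 ^ 2

theorem contDiff_normSq4 : ContDiff ℝ (⊤ : ℕ∞) normSq4 := by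
  unfold normSq4; fun_prop

theorem normSq4_smul (t : ℝ) (x : V4) : normSq4 (t • x) = t ^ 2 * normSq4 x := by
  simp [normSq4]; ring

theorem normSq4_pos {x : V4} (hx : x ≠ 0) : 0 < normSq4 x := by
  by_contra! h
  unfold normSq4 at h
  refine hx (funext fun i => pow_eq_zero_iff two_ne_zero |>.1 ?_)
  have h0 := sq_nonneg (x 0)
  have h1 := sq_nonneg (x 1)
  have h2 := sq_nonneg (x 2)
  have h3 := sq_nonneg (x 3)
  fin_cases i <;> simp only [Fin.zero_eta, Fin.mk_one, Fin.reduceFinMk] <;> linarith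

theorem exists_contDiff_eq_of_le_normSq4 {f : V4 → V4} {δ : ℝ} (hδ : 0 < δ)
    (hf : ∀ x, x ≠ 0 → ContDiffAt ℝ (⊤ : ℕ∞) f x) :
    ∃ g : V4 → V4, ContDiff ℝ (⊤ : ℕ∞) g ∧ ∀ x, δ ≤ normSq4 x → g x = f x := by
  refine ⟨fun x => Real.smoothTransition (2 * normSq4 x / δ - 1) • f x,
    contDiff_iff_contDiffAt.2 fun x => ?_, fun x hx => ?_⟩
  · by_cases hx : x = 0
    · have hev : ∀ᶠ y in nhds x, normSq4 y < δ / 2 := by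
        refine contDiff_normSq4.continuous.continuousAt.eventually (gt_mem_nhds ?_)
        rw [hx]; simpa [normSq4] using hδ
      refine (contDiffAt_const (c := (0 : V4))).congr_of_eventuallyEq ?_
      filter_upwards [hev] with y hy
      rw [Real.smoothTransition.zero_of_nonpos, zero_smul]
      rw [sub_nonpos, div_le_one hδ]; linarith
    · refine ContDiffAt.smul (Real.smoothTransition.contDiff.contDiffAt.comp x ?_) (hf x hx)
      exact ((((contDiff_const.mul contDiff_normSq4).div_const δ).sub contDiff_const)).contDiffAt
  · dsimp only
    rw [Real.smoothTransition.one_of_one_le, one_smul]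
    rw [le_sub_iff_add_le, le_div_iff₀ hδ]; linarith

theorem IsRadiallyTransverse.exists_sphere_diffeo {K : V4 → ℝ} {Ω : Set V4}
    (h : IsRadiallyTransverse K Ω) (h0 : K 0 ≠ 0) :
    ∃ φ ψ : V4 → V4, ContDiff ℝ (⊤ : ℕ∞) φ ∧ ContDiff ℝ (⊤ : ℕ∞) ψ ∧
      φ '' {x | x ∈ Ω ∧ K x = 0} = {y | normSq4 y = 1} ∧
      ψ '' {y | normSq4 y = 1} = {x | x ∈ Ω ∧ K x = 0} ∧
      (∀ x ∈ {x | x ∈ Ω ∧ K x = 0}, ψ (φ x) = x) ∧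
      (∀ y, normSq4 y = 1 → φ (ψ y) = y) := by
  obtain ⟨τ, hτ⟩ := h.exists_radius
  have hne : ∀ x ∈ {x | x ∈ Ω ∧ K x = 0}, x ≠ 0 := by
    rintro x ⟨-, hx⟩ rfl; exact h0 hx
  obtain ⟨δ, hδ, hδS⟩ : ∃ δ > 0, ∀ x ∈ {x | x ∈ Ω ∧ K x = 0}, δ ≤ normSq4 x :=
    (h.isCompact_zeroSet h0).exists_forall_le' (a := 0)
      contDiff_normSq4.continuous.continuousOn (fun x hx => normSq4_pos (hne x hx))
  obtain ⟨φ, hφ, hφS⟩ := exists_contDiff_eq_of_le_normSq4 (f := fun x => (√(normSq4 x))⁻¹ • x) hδ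
    (fun x hx => ((contDiff_normSq4.contDiffAt.sqrt (normSq4_pos hx).ne').inv
      (Real.sqrt_pos.2 (normSq4_pos hx)).ne').smul contDiffAt_id)
  obtain ⟨ψ, hψ, hψS⟩ := exists_contDiff_eq_of_le_normSq4 (f := fun x => τ x • x) one_pos
    (fun x hx => (hτ x hx).2.2.2.2.smul contDiffAt_id)
  have hne1 : ∀ y, normSq4 y = 1 → y ≠ 0 := by
    rintro y hy rfl; simp [normSq4] at hy
  have hmapsφ : ∀ x ∈ {x | x ∈ Ω ∧ K x = 0}, normSq4 (φ x) = 1 := fun x hx => by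
    have := normSq4_pos (hne x hx)
    rw [hφS x (hδS x hx), normSq4_smul, inv_pow, Real.sq_sqrt this.le, inv_mul_cancel₀ this.ne']
  have hmapsψ : ∀ y, normSq4 y = 1 → ψ y ∈ {x | x ∈ Ω ∧ K x = 0} := fun y hy => by
    rw [hψS y hy.ge]
    exact ⟨(hτ y (hne1 y hy)).2.1, (hτ y (hne1 y hy)).2.2.1⟩
  have hψφ : ∀ x ∈ {x | x ∈ Ω ∧ K x = 0}, ψ (φ x) = x := fun x hx => by
    have hs := Real.sqrt_pos.2 (normSq4_pos (hne x hx))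
    have h1 := hmapsφ x hx
    rw [hψS _ h1.ge]
    have hx' : √(normSq4 x) • φ x = x := by
      rw [hφS x (hδS x hx), smul_smul, mul_inv_cancel₀ hs.ne', one_smul]
    rw [← (hτ _ (hne1 _ h1)).2.2.2.1 _ hs (by rw [hx']; exact hx.1) (by rw [hx']; exact hx.2), hx']
  have hφψ : ∀ y, normSq4 y = 1 → φ (ψ y) = y := fun y hy => by
    have hp := (hτ y (hne1 y hy)).1
    rw [hφS _ (hδS _ (hmapsψ y hy)), hψS y hy.ge, normSq4_smul, hy, mul_one, Real.sqrt_sq hp.le,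
      smul_smul, inv_mul_cancel₀ hp.ne', one_smul]
  refine ⟨φ, ψ, hφ, hψ, ?_, ?_, hψφ, hφψ⟩
  · exact Subset.antisymm (image_subset_iff.2 hmapsφ)
      fun y hy => ⟨ψ y, hmapsψ y hy, hφψ y hy⟩
  · exact Subset.antisymm (image_subset_iff.2 hmapsψ)
      fun x hx => ⟨φ x, hmapsφ x hx, hψφ x hx⟩

theorem LCDisc.subset_LCDom {l : ℝ} (hl : l < 1) : LCDisc l ⊆ LCDom := fun x hx =>
  (lcAbs_pos (lt_trans (show 2 * (x 0 ^ 2 + x 1 ^ 2) < l from hx) hl)).ne'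

theorem Kham_zero (μ c : ℝ) : Kham μ c 0 = -(1 - μ) / 2 := by
  simp [Kham]; ring

theorem Kham_neg (μ c : ℝ) (x : V4) : Kham μ c (-x) = Kham μ c x := by
  simp [Kham, lcAbs]

theorem IsLagrangeDist.isRadiallyTransverse {μ l c : ℝ} (h : IsLagrangeDist μ l)
    (hμ : μ ∈ Ioo (0 : ℝ) 1) (hc : -c < effPotential μ l (1 - l)) :
    IsRadiallyTransverse (Kham μ c) (LCDisc l) where
  isOpen := isOpen_LCDisc l
  smul_mem x hx s hs := by
    have hx' : 2 * (x 0 ^ 2 + x 1 ^ 2) < l := hx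
    have hs2 : s ^ 2 ≤ 1 := pow_le_one₀ hs.1 hs.2
    have hB : 0 ≤ x 0 ^ 2 + x 1 ^ 2 := by positivity
    change 2 * ((s * x 0) ^ 2 + (s * x 1) ^ 2) < l
    rw [mul_pow, mul_pow]
    nlinarith
  contDiffAt x hx := contDiffAt_Kham μ c (LCDisc.subset_LCDom h.1.2 hx)
  radial_pos x hx hK := h.fderiv_Kham_self_pos hμ hc hx hK
  exists_zero x hx := by
    rcases (add_nonneg (sq_nonneg (x 0)) (sq_nonneg (x 1))).eq_or_lt with hB | hB
    · have h0 : x 0 = 0 := by nlinarith [sq_nonneg (x 0), sq_nonneg (x 1)]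
      have h1 : x 1 = 0 := by nlinarith [sq_nonneg (x 0), sq_nonneg (x 1)]
      have hw : 0 < x 2 ^ 2 + x 3 ^ 2 := by
        have := normSq4_pos hx
        unfold normSq4 at this
        linarith
      have hμ1 : 0 < 1 - μ := sub_pos.2 hμ.2
      refine ⟨√((1 - μ) / (x 2 ^ 2 + x 3 ^ 2)), Real.sqrt_pos.2 (by positivity), ?_, ?_⟩
      · simpa [LCDisc, h0, h1] using h.1.1
      · simp only [Kham, Pi.smul_apply, smul_eq_mul, h0, h1, mul_pow,
          Real.sq_sqrt (div_pos hμ1 hw).le]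
        field_simp
        ring
    · have hT : 0 < l / (2 * (x 0 ^ 2 + x 1 ^ 2)) := div_pos h.1.1 (by positivity)
      set T := √(l / (2 * (x 0 ^ 2 + x 1 ^ 2))) with hTdef
      have hT0 : 0 < T := Real.sqrt_pos.2 hT
      have hT2 : T ^ 2 * (2 * (x 0 ^ 2 + x 1 ^ 2)) = l := by
        rw [hTdef, Real.sq_sqrt hT.le, div_mul_cancel₀ _ (by positivity)]
      have hcoord : ∀ t : ℝ, 2 * ((t • x) 0 ^ 2 + (t • x) 1 ^ 2)
          = t ^ 2 * (2 * (x 0 ^ 2 + x 1 ^ 2)) := fun t => by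
        simp only [Pi.smul_apply, smul_eq_mul]; ring
      have hcont : ContinuousOn (fun t : ℝ => Kham μ c (t • x)) (Icc 0 T) := by
        intro t ht
        refine ContinuousAt.continuousWithinAt ?_
        have hdom : t • x ∈ LCDom := (lcAbs_pos (by
          rw [hcoord]
          have : t ^ 2 ≤ T ^ 2 := pow_le_pow_left₀ ht.1 ht.2 2
          nlinarith [h.1.2])).ne'
        exact ContinuousAt.comp (f := fun t : ℝ => t • x) (contDiffAt_Kham μ c hdom).continuousAt
          (by fun_prop)
      have hlow : Kham μ c ((0 : ℝ) • x) < 0 := by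
        rw [zero_smul, Kham_zero]; linarith [hμ.2]
      have hhigh : 0 < Kham μ c (T • x) := h.Kham_pos hμ hc (by rw [hcoord, hT2])
      obtain ⟨t, ht, hK⟩ := intermediate_value_Ioo hT0.le hcont ⟨hlow, hhigh⟩
      refine ⟨t, ht.1, ?_, hK⟩
      have : t ^ 2 < T ^ 2 := pow_lt_pow_left₀ ht.2 ht.1.le two_ne_zero
      change 2 * ((t • x) 0 ^ 2 + (t • x) 1 ^ 2) < l
      rw [hcoord, ← hT2]
      gcongr

theorem IsLagrangeDist.SigmaLC_eq {μ l c : ℝ} (h : IsLagrangeDist μ l)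
    (hμ : μ ∈ Ioo (0 : ℝ) 1) (hc : -c < effPotential μ l (1 - l)) :
    SigmaLC μ c = {x | x ∈ LCDisc l ∧ Kham μ c x = 0} := by
  have hrad := h.isRadiallyTransverse hμ hc
  have h0 : Kham μ c 0 ≠ 0 := by rw [Kham_zero]; linarith [hμ.2]
  set N := {x : V4 | x ∈ LCDom ∧ Kham μ c x = 0}
  set b : V4 := ![0, 0, √(1 - μ), 0] with hb
  have hbD : b ∈ LCDisc l := by simpa [LCDisc, hb] using h.1.1
  have hbK : Kham μ c b = 0 := by
    simp [Kham, hb, Real.sq_sqrt (sub_pos.2 hμ.2).le]; ring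
  have hsub : {x | x ∈ LCDisc l ∧ Kham μ c x = 0} ⊆ N := fun x hx =>
    ⟨LCDisc.subset_LCDom h.1.2 hx.1, hx.2⟩
  refine Subset.antisymm ?_ ?_
  · have hCN : SigmaLC μ c ⊆ N := connectedComponentIn_subset N b
    have hbC : b ∈ SigmaLC μ c := mem_connectedComponentIn (hsub ⟨hbD, hbK⟩)
    have hleft := IsPreconnected.subset_left_of_subset_union (isOpen_LCDisc l)
      (v := {x : V4 | l < 2 * (x 0 ^ 2 + x 1 ^ 2)})
      (isOpen_lt continuous_const (by fun_prop))
      (disjoint_left.2 fun x (hx : _ < l) (hx' : l < _) => lt_asymm hx hx')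
      (fun x hx => by
        rcases lt_trichotomy (2 * (x 0 ^ 2 + x 1 ^ 2)) l with hl | hl | hl
        · exact Or.inl hl
        · exact absurd (hCN hx).2 (h.Kham_pos hμ hc hl).ne'
        · exact Or.inr hl)
      ⟨b, hbC, hbD⟩ (isPreconnected_connectedComponentIn (F := N) (x := b))
    exact fun x hx => ⟨hleft hx, (hCN hx).2⟩
  · exact (hrad.isPreconnected_zeroSet h0 (by simp)).subset_connectedComponentIn
      ⟨hbD, hbK⟩ hsub

/-- For `μ ∈ (0,1)` and `-c` below the smallest critical value of the Jacobi
Hamiltonian, `Σ_{μ,c}` is a compact regular hypersurface in `ℝ⁴`, starshaped with respect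
to the origin (every ray from the origin meets it in exactly one point), hence
diffeomorphic to `S³` (we express the diffeomorphism by a pair of smooth ambient maps,
inverse to each other on `Σ_{μ,c}` and on the unit sphere); moreover `Σ_{μ,c}` is
invariant under the symplectic involution `s(z,w) = (-z,-w)`. -/
theorem statement18 (μ c : ℝ) (hμ : μ ∈ Set.Ioo (0:ℝ) 1)
    (hc : -c < sInf (JacobiCritVals μ)) :
    IsCompact (SigmaLC μ c) ∧
    (∀ x ∈ SigmaLC μ c, x ∈ LCDom ∧ fderiv ℝ (Kham μ c) x ≠ 0) ∧
    (∀ x : V4, x ≠ 0 → ∃! t : ℝ, 0 < t ∧ t • x ∈ SigmaLC μ c) ∧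
    (∃ φ ψ : V4 → V4, ContDiff ℝ (⊤ : ℕ∞) φ ∧ ContDiff ℝ (⊤ : ℕ∞) ψ ∧
      φ '' SigmaLC μ c = {y : V4 | (y 0)^2 + (y 1)^2 + (y 2)^2 + (y 3)^2 = 1} ∧
      ψ '' {y : V4 | (y 0)^2 + (y 1)^2 + (y 2)^2 + (y 3)^2 = 1} = SigmaLC μ c ∧
      (∀ x ∈ SigmaLC μ c, ψ (φ x) = x) ∧
      (∀ y : V4, (y 0)^2 + (y 1)^2 + (y 2)^2 + (y 3)^2 = 1 → φ (ψ y) = y)) ∧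
    (∀ x ∈ SigmaLC μ c, -x ∈ SigmaLC μ c) := by
  obtain ⟨l, hl⟩ := exists_isLagrangeDist hμ
  have hc' := hl.neg_lt hμ hc
  have hrad := hl.isRadiallyTransverse hμ hc'
  have h0 : Kham μ c 0 ≠ 0 := by rw [Kham_zero]; linarith [hμ.2]
  rw [hl.SigmaLC_eq hμ hc']
  refine ⟨hrad.isCompact_zeroSet h0, fun x hx => ⟨LCDisc.subset_LCDom hl.1.2 hx.1, fun hd => ?_⟩,
    fun x hx => hrad.existsUnique hx, hrad.exists_sphere_diffeo h0, fun x hx => ⟨?_, ?_⟩⟩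
  · have := hrad.radial_pos x hx.1 hx.2
    rw [hd] at this
    exact lt_irrefl _ this
  · simpa [LCDisc] using hx.1
  · rw [Kham_neg]; exact hx.2
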